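/- arXiv:2505.11428 — 2 statements merged into one kernel-verified Lean document; each statement's English description precedes it below -/
import Mathlib

section
/- Let ε > 0 and define v : ℝ³ → ℝ³ by v(ξ) = ξ/√(1 + ε²|ξ|²). Then for every ξ ∈ ℝ³, the operator norm of the difference between the Fréchet derivative of v at ξ and the identity map satisfies ‖Dv(ξ) − Id‖ ≤ 2 ε² |ξ|². -/
/-- The relativistic velocity map `v(ξ) = ξ / √(1 + ε²|ξ|²)` on ℝ³. -/
noncomputable def relVel (ε : ℝ) (ξ : EuclideanSpace ℝ (Fin 3)) : EuclideanSpace ℝ (Fin 3) :=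
  (Real.sqrt (1 + ε ^ 2 * ‖ξ‖ ^ 2))⁻¹ • ξ

open ContinuousLinearMap in
/-- The derivative of `ξ ↦ ξ / √(1 + ε²|ξ|²)` on a real inner product space. -/
theorem hasFDerivAt_inv_sqrt_one_add_smul {E : Type*} [NormedAddCommGroup E]
    [InnerProductSpace ℝ E] (ε : ℝ) (ξ : E) :
    HasFDerivAt (fun x : E => (Real.sqrt (1 + ε ^ 2 * ‖x‖ ^ 2))⁻¹ • x)
      ((Real.sqrt (1 + ε ^ 2 * ‖ξ‖ ^ 2))⁻¹ • ContinuousLinearMap.id ℝ E -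
        (ε ^ 2 / Real.sqrt (1 + ε ^ 2 * ‖ξ‖ ^ 2) ^ 3) • (innerSL ℝ ξ).smulRight ξ) ξ := by
  have hpos : 0 < 1 + ε ^ 2 * ‖ξ‖ ^ 2 := by positivity
  have hs : 0 < Real.sqrt (1 + ε ^ 2 * ‖ξ‖ ^ 2) := Real.sqrt_pos.2 hpos
  have hnorm := (((hasStrictFDerivAt_norm_sq ξ).hasFDerivAt).const_mul (ε ^ 2)).const_add 1
  have hinv := ((Real.hasDerivAt_sqrt hpos.ne').fun_inv hs.ne').comp_hasFDerivAt ξ hnorm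
  refine (hinv.smul (hasFDerivAt_id ξ)).congr_fderiv ?_
  ext h
  simp only [Function.comp_apply, id, add_apply, smul_apply, smulRight_apply,
    innerSL_apply_apply, coe_id', smul_eq_mul, sub_eq_add_neg, smul_smul, ← neg_smul]
  congr 2
  simp only [nsmul_eq_mul, Nat.cast_ofNat]
  field_simp

/-- Pointwise bound on the relativistic correction of the Jacobian:
`‖Dv(ξ) − Id‖ ≤ 2 ε² |ξ|²` in operator norm. -/
theorem stmt7 (ε : ℝ) (hε : 0 < ε) (ξ : EuclideanSpace ℝ (Fin 3)) :
    ‖fderiv ℝ (relVel ε) ξ - ContinuousLinearMap.id ℝ (EuclideanSpace ℝ (Fin 3))‖ ≤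
      2 * ε ^ 2 * ‖ξ‖ ^ 2 := by
  have hderiv : fderiv ℝ (relVel ε) ξ = _ := (hasFDerivAt_inv_sqrt_one_add_smul ε ξ).fderiv
  rw [hderiv]
  have hr : 0 ≤ ε ^ 2 * ‖ξ‖ ^ 2 := by positivity
  have hsq : Real.sqrt (1 + ε ^ 2 * ‖ξ‖ ^ 2) ^ 2 = 1 + ε ^ 2 * ‖ξ‖ ^ 2 :=
    Real.sq_sqrt (by positivity)
  have hs : 1 ≤ Real.sqrt (1 + ε ^ 2 * ‖ξ‖ ^ 2) := Real.one_le_sqrt.2 (by linarith)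
  set s := Real.sqrt (1 + ε ^ 2 * ‖ξ‖ ^ 2)
  have hs0 : 0 < s := by linarith
  have hid : 1 - s⁻¹ ≤ ε ^ 2 * ‖ξ‖ ^ 2 := by
    have : 1 - s⁻¹ = (s - 1) / s := by field_simp
    rw [this, div_le_iff₀ hs0]
    nlinarith
  have hrank : ε ^ 2 / s ^ 3 ≤ ε ^ 2 := div_le_self (by positivity) (one_le_pow₀ hs)
  have hs1 : s⁻¹ ≤ 1 := inv_le_one_of_one_le₀ hs
  refine ContinuousLinearMap.opNorm_le_bound _ (by positivity) fun h => ?_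
  have heq : (s⁻¹ • ContinuousLinearMap.id ℝ (EuclideanSpace ℝ (Fin 3)) -
      (ε ^ 2 / s ^ 3) • (innerSL ℝ ξ).smulRight ξ -
      ContinuousLinearMap.id ℝ (EuclideanSpace ℝ (Fin 3))) h =
      (s⁻¹ - 1) • h - (ε ^ 2 / s ^ 3) • inner ℝ ξ h • ξ := by
    simp only [sub_apply, smul_apply,
      ContinuousLinearMap.smulRight_apply, innerSL_apply_apply, ContinuousLinearMap.coe_id', id,
      sub_smul, one_smul]
    abel
  rw [heq]
  calc ‖(s⁻¹ - 1) • h - (ε ^ 2 / s ^ 3) • inner ℝ ξ h • ξ‖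
      ≤ ‖(s⁻¹ - 1) • h‖ + ‖(ε ^ 2 / s ^ 3) • inner ℝ ξ h • ξ‖ := norm_sub_le _ _
    _ = (1 - s⁻¹) * ‖h‖ + ε ^ 2 / s ^ 3 * (|inner ℝ ξ h| * ‖ξ‖) := by
        rw [norm_smul, norm_smul, norm_smul, Real.norm_eq_abs, Real.norm_eq_abs, Real.norm_eq_abs,
          abs_of_nonpos (by linarith : s⁻¹ - 1 ≤ 0),
          abs_of_nonneg (by positivity : 0 ≤ ε ^ 2 / s ^ 3), neg_sub]
    _ ≤ ε ^ 2 * ‖ξ‖ ^ 2 * ‖h‖ + ε ^ 2 * (‖ξ‖ * ‖h‖ * ‖ξ‖) := by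
        gcongr
        exact abs_real_inner_le_norm ξ h
    _ = 2 * ε ^ 2 * ‖ξ‖ ^ 2 * ‖h‖ := by ring
end

section
/- There exists a constant C > 0 such that for every continuous function g : ℝ → ℝ, every M ≥ 0 with |g(σ)| ≤ M for all σ, every ε > 0 and every t ≥ 0, one has |∫₀ᵗ ((1/(2πε)) ∫ₛ^{s+2πε} g(σ)(1 − cos((s−σ)/ε)) dσ) ds − ∫₀ᵗ g(s) ds| ≤ C ε M. -/
open intervalIntegral

/-- Translating the integrand of a bounded function by `u` changes its integral over an interval
by at most two boundary layers of width `|u|`. -/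
theorem abs_integral_comp_add_sub_integral_le {g : ℝ → ℝ} (hg : Continuous g) {M : ℝ}
    (hM : ∀ x, |g x| ≤ M) (a b u : ℝ) :
    |(∫ s in a..b, g (s + u)) - ∫ s in a..b, g s| ≤ 2 * M * |u| := by
  have hi : ∀ x y : ℝ, IntervalIntegrable g MeasureTheory.volume x y :=
    fun x y => hg.intervalIntegrable x y
  have hb : ∀ x : ℝ, |∫ s in x..(x + u), g s| ≤ M * |u| := fun x => by
    simpa using norm_integral_le_of_norm_le_const (a := x) (b := x + u) (f := g)
      fun y _ => hM y
  have hsplit : (∫ s in a..b, g (s + u)) - ∫ s in a..b, g s =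
      (∫ s in b..(b + u), g s) - ∫ s in a..(a + u), g s := by
    rw [integral_comp_add_right]
    have h₁ := integral_add_adjacent_intervals (hi a (a + u)) (hi (a + u) (b + u))
    have h₂ := integral_add_adjacent_intervals (hi a b) (hi b (b + u))
    linarith
  rw [hsplit]
  calc _ ≤ |∫ s in b..(b + u), g s| + |∫ s in a..(a + u), g s| := abs_sub _ _
    _ ≤ 2 * M * |u| := by linarith [hb a, hb b]

/-- The kernel `1 - cos (u / ε)` has average one over its period. -/
theorem integral_one_sub_cos_div {ε : ℝ} (hε : ε ≠ 0) :
    ∫ u in (0 : ℝ)..(2 * Real.pi * ε), (1 - Real.cos (u / ε)) = 2 * Real.pi * ε := by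
  have hc : Continuous fun u : ℝ => Real.cos (u / ε) := by fun_prop
  rw [integral_sub (by simp) (hc.intervalIntegrable _ _), integral_comp_div _ hε]
  simp [hε]

/-- A sliding average may be integrated by first integrating the translates of `g`. -/
theorem integral_sliding_kernel {g k : ℝ → ℝ} (hg : Continuous g) (hk : Continuous k)
    (a b P : ℝ) :
    ∫ s in a..b, ∫ σ in s..(s + P), g σ * k (s - σ) =
      ∫ u in (0 : ℝ)..P, k (-u) * ∫ s in a..b, g (s + u) := by
  have h : ∀ s : ℝ, ∫ σ in s..(s + P), g σ * k (s - σ) =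
      ∫ u in (0 : ℝ)..P, k (-u) * g (s + u) := fun s => by
    have := integral_comp_add_left (a := 0) (b := P) (fun σ => g σ * k (s - σ)) s
    rw [add_zero] at this
    rw [← this]
    refine integral_congr fun u _ => ?_
    simp [mul_comm]
  simp_rw [h]
  rw [MeasureTheory.intervalIntegral_intervalIntegral_swap]
  · simp_rw [integral_const_mul]
  · have hc : Continuous (Function.uncurry fun s u : ℝ => k (-u) * g (s + u)) := by
      unfold Function.uncurry
      fun_prop
    exact (hc.continuousOn.integrableOn_compact
      (isCompact_uIcc.prod isCompact_uIcc)).mono_set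
      (Set.prod_mono Set.uIoc_subset_uIcc Set.uIoc_subset_uIcc)

/-- Remainder estimate for the sliding time average over one oscillation period:
the time-integrated average of `g` against the kernel `1 − cos((s−σ)/ε)` differs
from `∫₀ᵗ g` only by `O(εM)`, uniformly in `g`, `ε` and `t`. -/
theorem stmt14 : ∃ C : ℝ, 0 < C ∧
    ∀ g : ℝ → ℝ, Continuous g → ∀ M : ℝ, 0 ≤ M → (∀ σ : ℝ, |g σ| ≤ M) →
    ∀ ε : ℝ, 0 < ε → ∀ t : ℝ, 0 ≤ t →
      |(∫ s in (0:ℝ)..t, (1 / (2 * Real.pi * ε)) *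
          ∫ σ in s..(s + 2 * Real.pi * ε), g σ * (1 - Real.cos ((s - σ) / ε))) -
        ∫ s in (0:ℝ)..t, g s| ≤ C * ε * M := by
  refine ⟨8 * Real.pi, by positivity, fun g hg M hM hgM ε hε t _ => ?_⟩
  have hP : 0 < 2 * Real.pi * ε := by positivity
  rw [integral_const_mul,
    integral_sliding_kernel (k := fun x => 1 - Real.cos (x / ε)) hg (by fun_prop)]
  simp only [neg_div, Real.cos_neg]
  set P := 2 * Real.pi * ε with hPdef
  set I := ∫ s in (0 : ℝ)..t, g s
  have hG : Continuous fun u : ℝ => ∫ s in (0 : ℝ)..t, g (s + u) :=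
    continuous_parametric_intervalIntegral_of_continuous' (by fun_prop) 0 t
  have hdiff : (∫ u in (0 : ℝ)..P, (1 - Real.cos (u / ε)) * ∫ s in (0 : ℝ)..t, g (s + u)) -
      P * I = ∫ u in (0 : ℝ)..P,
        (1 - Real.cos (u / ε)) * ((∫ s in (0 : ℝ)..t, g (s + u)) - I) := by
    have hk : Continuous fun u : ℝ => 1 - Real.cos (u / ε) := by fun_prop
    simp_rw [mul_sub]
    rw [integral_sub ((hk.fun_mul hG).intervalIntegrable _ _)
      ((hk.fun_mul continuous_const).intervalIntegrable _ _), integral_mul_const,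
      integral_one_sub_cos_div hε.ne']
  have hbound : |∫ u in (0 : ℝ)..P,
      (1 - Real.cos (u / ε)) * ((∫ s in (0 : ℝ)..t, g (s + u)) - I)| ≤
      2 * (2 * M * P) * P := by
    have := norm_integral_le_of_norm_le_const (a := 0) (b := P) (C := 2 * (2 * M * P))
      (f := fun u => (1 - Real.cos (u / ε)) * ((∫ s in (0 : ℝ)..t, g (s + u)) - I))
      fun u hu => by
        rw [Set.uIoc_of_le hP.le] at hu
        rw [Real.norm_eq_abs, abs_mul]
        have hk : |1 - Real.cos (u / ε)| ≤ 2 := by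
          rw [abs_le]
          constructor <;> linarith [Real.cos_le_one (u / ε), Real.neg_one_le_cos (u / ε)]
        have hu' : |u| ≤ P := by
          rw [abs_of_pos hu.1]
          exact hu.2
        have hs := (abs_integral_comp_add_sub_integral_le hg hgM 0 t u).trans
          (mul_le_mul_of_nonneg_left hu' (by positivity))
        exact mul_le_mul hk hs (abs_nonneg _) zero_le_two
    simpa [abs_of_pos hP] using this
  rw [← hdiff] at hbound
  calc _ = 1 / P * |(∫ u in (0 : ℝ)..P,
        (1 - Real.cos (u / ε)) * ∫ s in (0 : ℝ)..t, g (s + u)) - P * I| := by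
        rw [← abs_of_pos (one_div_pos.2 hP), ← abs_mul, abs_of_pos (one_div_pos.2 hP), mul_sub,
          ← mul_assoc (1 / P) P, one_div_mul_cancel hP.ne', one_mul]
    _ ≤ 1 / P * (2 * (2 * M * P) * P) := by gcongr
    _ = 8 * Real.pi * ε * M := by
        field_simp
        rw [hPdef]
        ring
end
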